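/- The cup product on cubical cochains, defined for φ ∈ C^p(X;R), ψ ∈ C^q(X;R) and u ∈ X_{p+q} by (φ ⌣ ψ)(u) = Σ_{|G|=p} ρ_{GK} φ(u ∘ λ_G^0) · ψ(u ∘ λ_K^1) (sum over p-element subsets G ⊆ {1,...,p+q}, K the complement, ρ_{GK} the shuffle sign), is associative. -/

import Mathlib

/- A precubical set: sets `X n` with face maps `∂_i^ε : X (n+1) → X n` (`i : Fin (n+1)`,
0-based) satisfying the precubical identities. -/
structure Precubical where
  X : ℕ → Type
  face : ∀ n, Fin (n + 1) → Bool → X (n + 1) → X n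
  comm : ∀ n (i : Fin (n + 1)) (j : Fin (n + 2)) (hij : (i : ℕ) < (j : ℕ))
    (α β : Bool) (x : X (n + 2)),
    face n i α (face (n + 1) j β x) =
      face n ⟨(j : ℕ) - 1, by omega⟩ β (face (n + 1) ⟨(i : ℕ), by omega⟩ α x)

/- Remove index `i`, shifting the indices above `i` down by one. -/
def dropAt {m : ℕ} (i : Fin (m + 1)) (x : Fin (m + 1)) (hx : x ≠ i) : Fin m :=
  if h : (x : ℕ) < (i : ℕ) then ⟨x, by omega⟩
  else ⟨(x : ℕ) - 1, by
    have hx' : (x : ℕ) ≠ (i : ℕ) := fun he => hx (Fin.ext he)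
    have := x.isLt; omega⟩

/- `mfaceAux C k G _ ε x` is the iterated face `x ∘ λ_G^ε` of the cube `x`, obtained by
deleting (with value `ε`) the coordinates not in `G`, from the largest one down;
`k` counts the number of deletions. -/
noncomputable def mfaceAux (C : Precubical) :
    (k : ℕ) → {n : ℕ} → (G : Finset (Fin n)) → n - G.card = k → Bool → C.X n → C.X G.card
  | 0, n, G, h, _, x =>
      cast (congrArg C.X (by have := Finset.card_le_univ G; simp at this; omega)) x
  | _+1, 0, _, h, _, _ => absurd h (by omega)
  | k+1, n'+1, G, h, ε, x =>
      have hne : Gᶜ.Nonempty := Finset.card_pos.mp (by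
        rw [Finset.card_compl]; simp only [Fintype.card_fin]; omega)
      have hiG : Gᶜ.max' hne ∉ G := by simpa using Gᶜ.max'_mem hne
      have hinj : Function.Injective
          (fun y : {a // a ∈ G} => dropAt (Gᶜ.max' hne) y.1 (fun he => hiG (he ▸ y.2))) := by
        intro a b hab
        apply Subtype.ext; apply Fin.ext
        unfold dropAt at hab
        simp only at hab
        have ha : (a.1 : ℕ) ≠ (Gᶜ.max' hne : ℕ) :=
          fun he => hiG (Fin.ext he ▸ a.2)
        have hb : (b.1 : ℕ) ≠ (Gᶜ.max' hne : ℕ) :=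
          fun he => hiG (Fin.ext he ▸ b.2)
        split_ifs at hab <;> (simp only [Fin.mk.injEq] at hab; omega)
      have hcard : (G.attach.image
          (fun y : {a // a ∈ G} => dropAt (Gᶜ.max' hne) y.1 (fun he => hiG (he ▸ y.2)))).card
          = G.card := by
        rw [Finset.card_image_of_injective _ hinj, Finset.card_attach]
      cast (congrArg C.X hcard)
        (mfaceAux C k
          (G.attach.image (fun y : {a // a ∈ G} => dropAt (Gᶜ.max' hne) y.1 (fun he => hiG (he ▸ y.2))))
          (by rw [hcard]; have := Finset.card_le_univ G; simp at this; omega)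
          ε (C.face n' (Gᶜ.max' hne) ε x))

/- `mface C G ε x = x ∘ λ_G^ε`, the `G.card`-dimensional face of the cube `x` in which all
coordinates outside `G` are set to `ε`. -/
noncomputable def mface (C : Precubical) {n : ℕ} (G : Finset (Fin n)) (ε : Bool)
    (x : C.X n) : C.X G.card :=
  mfaceAux C (n - G.card) G rfl ε x

/- `ρ_{GK}`: the sign of the shuffle permutation listing the elements of `G` in increasing
order followed by those of its complement `K`, computed as `(-1)^inversions`. -/
def shuffleSign {n : ℕ} (G : Finset (Fin n)) : ℤ :=
  (-1) ^ (∑ g ∈ G, (Gᶜ.filter (· < g)).card)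

/- The cubical cup product `(φ ⌣ ψ)(u) = Σ_{|G|=p} ρ_{GK} φ(u∘λ_G^0) ψ(u∘λ_K^1)`. -/
noncomputable def cup (C : Precubical) {R : Type} [NonUnitalNonAssocRing R] {p q : ℕ}
    (φ : C.X p → R) (ψ : C.X q → R) (u : C.X (p + q)) : R :=
  ∑ G : Finset (Fin (p + q)),
    if h : G.card = p then
      shuffleSign G •
        (φ (cast (congrArg C.X h) (mface C G false u)) *
         ψ (cast (congrArg C.X (by rw [Finset.card_compl]; simp only [Fintype.card_fin]; omega))
              (mface C Gᶜ true u)))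
    else 0

/- The cubical coboundary `δ = Σ_{i=1}^{n+1} (−1)^i (δ_i^1 − δ_i^0)`,
`(δ_i^ε f)(ϑ) = f(∂_i^ε ϑ)` (0-based `i`, hence sign `(−1)^{i+1}`). -/
def cobnd (C : Precubical) {R : Type} [NonUnitalNonAssocRing R] {n : ℕ}
    (f : C.X n → R) (ϑ : C.X (n + 1)) : R :=
  ∑ i : Fin (n + 1), (-1 : ℤ) ^ ((i : ℕ) + 1) •
    (f (C.face n i true ϑ) - f (C.face n i false ϑ))

namespace Precubical

/-- The disjoint union of all cube sets; working here avoids transports along dimensions. -/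
abbrev Cube (C : Precubical) : Type := Σ n, C.X n

/-- The face operator on cubes of arbitrary dimension, the identity if the index is too large. -/
def cubeFace (C : Precubical) (i : ℕ) (ε : Bool) : C.Cube → C.Cube
  | ⟨0, x⟩ => ⟨0, x⟩
  | ⟨n + 1, x⟩ => if h : i < n + 1 then ⟨n, C.face n ⟨i, h⟩ ε x⟩ else ⟨n + 1, x⟩

variable {C : Precubical}

lemma cubeFace_of_lt {n i : ℕ} (h : i < n + 1) (ε : Bool) (x : C.X (n + 1)) :
    C.cubeFace i ε ⟨n + 1, x⟩ = ⟨n, C.face n ⟨i, h⟩ ε x⟩ := by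
  simp [cubeFace, h]

lemma cubeFace_of_le {i : ℕ} (ε : Bool) {y : C.Cube} (h : y.1 ≤ i) : C.cubeFace i ε y = y := by
  obtain ⟨_ | n, x⟩ := y
  · rfl
  · have : ¬ i < n + 1 := by simpa using h
    simp [cubeFace, this]

lemma dim_cubeFace {i : ℕ} (ε : Bool) {y : C.Cube} (h : i < y.1) :
    (C.cubeFace i ε y).1 + 1 = y.1 := by
  obtain ⟨_ | n, x⟩ := y
  · simp at h
  · rw [cubeFace_of_lt h]

lemma cubeFace_cubeFace {i j : ℕ} (hij : i ≤ j) (α β : Bool) (y : C.Cube) :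
    C.cubeFace i α (C.cubeFace (j + 1) β y) = C.cubeFace j β (C.cubeFace i α y) := by
  rcases le_or_gt y.1 (j + 1) with hj | hj
  · rw [cubeFace_of_le β hj]
    rcases le_or_gt y.1 i with hi | hi
    · rw [cubeFace_of_le α hi, cubeFace_of_le β (by omega)]
    · have := dim_cubeFace α hi
      rw [cubeFace_of_le β (y := C.cubeFace i α y) (by omega)]
  · obtain ⟨_ | _ | n, x⟩ := y
    · simp at hj
    · simp at hj
    · simp only at hj
      rw [cubeFace_of_lt hj, cubeFace_of_lt (by omega), cubeFace_of_lt (by omega),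
        cubeFace_of_lt (by omega)]
      exact congrArg (Sigma.mk n)
        (C.comm n ⟨i, by omega⟩ ⟨j + 1, hj⟩ (by simp; omega) α β x)

/-- The face of a cube prescribed by a word: the letters describe the coordinates from the `k`-th
one on, `none` keeping the coordinate and `some ε` setting it to `ε`. -/
def wordFace (C : Precubical) : ℕ → List (Option Bool) → C.Cube → C.Cube
  | _, [], y => y
  | k, none :: w, y => wordFace C (k + 1) w y
  | k, some ε :: w, y => C.cubeFace k ε (wordFace C (k + 1) w y)

lemma wordFace_cubeFace {j k : ℕ} (hkj : k ≤ j) (ε : Bool) (w : List (Option Bool)) (y : C.Cube) :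
    C.wordFace j w (C.cubeFace k ε y) = C.cubeFace k ε (C.wordFace (j + 1) w y) := by
  induction w generalizing j with
  | nil => rfl
  | cons a w ih =>
    cases a with
    | none => exact ih (by omega)
    | some β =>
      simp only [wordFace]
      rw [ih (by omega), cubeFace_cubeFace hkj]

lemma dim_wordFace (k : ℕ) (w : List (Option Bool)) (y : C.Cube) (h : k + w.length ≤ y.1) :
    (C.wordFace k w y).1 + w.countP Option.isSome = y.1 := by
  induction w generalizing k with
  | nil => rfl
  | cons a w ih =>
    have hw := ih (k + 1) (by simp at h; omega)
    cases a with
    | none => simpa [wordFace] using hw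
    | some ε =>
      have hc := w.countP_le_length (p := Option.isSome)
      have := dim_cubeFace (i := k) ε (y := C.wordFace (k + 1) w y) (by simp at h; omega)
      simp only [wordFace, List.countP_cons, Option.isSome_some, if_true]
      omega

/-- Substitute the letters of the second word for the occurrences of `none` in the first one. -/
def substWord : List (Option Bool) → List (Option Bool) → List (Option Bool)
  | [], v => v
  | some ε :: w, v => some ε :: substWord w v
  | none :: w, [] => none :: w
  | none :: w, a :: v => a :: substWord w v

lemma wordFace_wordFace (k : ℕ) (v w : List (Option Bool)) (y : C.Cube) :
    C.wordFace k v (C.wordFace k w y) = C.wordFace k (substWord w v) y := by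
  induction w generalizing k v with
  | nil => rfl
  | cons a w ih =>
    cases a with
    | some ε =>
      simp only [wordFace, substWord]
      rw [wordFace_cubeFace le_rfl, ih]
    | none =>
      cases v with
      | nil => rfl
      | cons b v => cases b <;> simp only [wordFace, substWord, ih]

lemma wordFace_eraseIdx (k i : ℕ) (ε : Bool) (w : List (Option Bool)) (y : C.Cube)
    (h : w[i]? = some (some ε)) :
    C.wordFace k (w.eraseIdx i) (C.cubeFace (k + i) ε y) = C.wordFace k w y := by
  induction w generalizing k i with
  | nil => simp at h
  | cons a w ih =>
    cases i with
    | zero =>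
      obtain rfl : a = some ε := by simpa using h
      exact wordFace_cubeFace le_rfl ε w y
    | succ i =>
      have := ih (k + 1) i (by simpa using h)
      rw [show k + 1 + i = k + (i + 1) by omega] at this
      cases a <;> simp only [List.eraseIdx_cons_succ, wordFace, this]

lemma wordFace_replicate_none (k n : ℕ) (y : C.Cube) :
    C.wordFace k (List.replicate n none) y = y := by
  induction n generalizing k with
  | zero => rfl
  | succ n ih => exact ih (k + 1)

/-- The indicator word of a set of coordinates. -/
def indicator {n : ℕ} (G : Finset (Fin n)) : List Bool := List.ofFn fun i => decide (i ∈ G)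

/-- The letter keeping a coordinate marked `b` and setting the others to `ε`. -/
def keep (b ε : Bool) (a : Bool) : Option Bool := if a = b then none else some ε

lemma eraseIdx_ofFn {α : Type*} {n : ℕ} (f : Fin (n + 1) → α) (i : Fin (n + 1)) :
    (List.ofFn f).eraseIdx i = List.ofFn fun j => f (i.succAbove j) := by
  apply List.ext_getElem
  · simp [List.length_eraseIdx, i.is_le]
  · intro j h₁ h₂
    simp only [List.getElem_eraseIdx, List.getElem_ofFn]
    split_ifs with h <;> simp [Fin.succAbove, Fin.lt_def, h]

lemma dropAt_eq_iff {n : ℕ} (i x : Fin (n + 1)) (hx : x ≠ i) (j : Fin n) :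
    dropAt i x hx = j ↔ x = i.succAbove j := by
  have : (x : ℕ) ≠ i := fun h => hx (Fin.ext h)
  unfold dropAt Fin.succAbove
  split_ifs with h₁ h₂ h₂ <;> simp [Fin.ext_iff, Fin.lt_def] at * <;> omega

lemma sigma_mk_cast {m n : ℕ} (h : m = n) (x : C.X m) :
    (⟨n, cast (congrArg C.X h) x⟩ : C.Cube) = ⟨m, x⟩ := by
  subst h; rfl

lemma sigma_mfaceAux (k : ℕ) {n : ℕ} (G : Finset (Fin n)) (h : n - G.card = k) (ε : Bool)
    (x : C.X n) :
    (⟨G.card, mfaceAux C k G h ε x⟩ : C.Cube) =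
      C.wordFace 0 ((indicator G).map (keep true ε)) ⟨n, x⟩ := by
  induction k generalizing n with
  | zero =>
    have hle := Finset.card_le_univ G
    simp only [Fintype.card_fin] at hle
    obtain rfl : G = Finset.univ := (Finset.card_eq_iff_eq_univ G).mp (by simp; omega)
    rw [mfaceAux, sigma_mk_cast (by simp)]
    simp [indicator, keep, wordFace_replicate_none, List.ofFn_const]
  | succ k ih =>
    cases n with
    | zero => omega
    | succ n =>
      rw [mfaceAux]
      have hne : Gᶜ.Nonempty := Finset.card_pos.mp (by
        rw [Finset.card_compl]; simp only [Fintype.card_fin]; omega)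
      have hiG : Gᶜ.max' hne ∉ G := by simpa using Gᶜ.max'_mem hne
      rw [sigma_mk_cast, ih, ← cubeFace_of_lt (Gᶜ.max' hne).isLt,
        ← wordFace_eraseIdx 0 (Gᶜ.max' hne) ε _ ⟨n + 1, x⟩, zero_add]
      · congr 1
        rw [List.eraseIdx_map, indicator, indicator, eraseIdx_ofFn]
        congr 2
        funext j
        simp [dropAt_eq_iff]
      · simp only [indicator, List.map_ofFn, List.getElem?_ofFn]
        simp [keep, hiG, Fin.is_le]
      · refine (Finset.card_image_of_injective _ fun a b hab => Subtype.ext ?_).trans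
          Finset.card_attach
        exact ((dropAt_eq_iff _ _ _ _).mp hab).trans ((dropAt_eq_iff _ _ _ _).mp rfl).symm

lemma sigma_mface {n : ℕ} (G : Finset (Fin n)) (ε : Bool) (x : C.X n) :
    (⟨G.card, mface C G ε x⟩ : C.Cube) =
      C.wordFace 0 ((indicator G).map (keep true ε)) ⟨n, x⟩ :=
  sigma_mfaceAux _ G rfl ε x

lemma sigma_mface_compl {n : ℕ} (G : Finset (Fin n)) (ε : Bool) (x : C.X n) :
    (⟨Gᶜ.card, mface C Gᶜ ε x⟩ : C.Cube) =
      C.wordFace 0 ((indicator G).map (keep false ε)) ⟨n, x⟩ := by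
  rw [sigma_mface]
  congr 1
  simp [indicator, keep, Function.comp_def]

/-- The sign of the shuffle described by a word, `true` marking the first block. -/
def wordSign : List Bool → ℤ
  | [] => 1
  | true :: w => wordSign w
  | false :: w => (-1) ^ w.count true * wordSign w

lemma count_true_ofFn {n : ℕ} (a : Fin n → Bool) :
    (List.ofFn a).count true = ∑ i, if a i = true then 1 else 0 := by
  induction n with
  | zero => rfl
  | succ n ih =>
    rw [List.ofFn_succ, List.count_cons, ih, Fin.sum_univ_succ, add_comm]
    simp

lemma wordSign_ofFn {n : ℕ} (a : Fin n → Bool) :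
    wordSign (List.ofFn a) =
      (-1) ^ ∑ i, if a i = true then ∑ j, if a j = false ∧ j < i then 1 else 0 else 0 := by
  induction n with
  | zero => simp [wordSign]
  | succ n ih =>
    have hcount : (List.ofFn fun i : Fin n => a i.succ).count true =
        ∑ i : Fin n, if a i.succ = true then 1 else 0 := count_true_ofFn _
    rw [List.ofFn_succ, Fin.sum_univ_succ]
    simp only [Fin.sum_univ_succ (n := n), Fin.succ_lt_succ_iff]
    cases h : a 0
    · simp only [wordSign, ih, hcount, ← pow_add, ← Finset.sum_add_distrib]
      simp only [Bool.false_eq_true, if_false, zero_add, Fin.succ_pos, and_true, if_true]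
      congr 1
      apply Finset.sum_congr rfl
      intro i _
      split_ifs <;> simp
    · simp [wordSign, ih]

lemma shuffleSign_eq_wordSign {n : ℕ} (G : Finset (Fin n)) :
    shuffleSign G = wordSign (indicator G) := by
  rw [indicator, wordSign_ofFn, shuffleSign]
  simp only [decide_eq_true_eq, decide_eq_false_iff_not, ← Finset.card_filter]
  rw [← Finset.sum_filter, Finset.filter_univ_mem]
  congr 1
  refine Finset.sum_congr rfl fun g _ => congrArg Finset.card ?_
  ext j
  simp

variable {R : Type}

/-- The sum of a function over all words of length `n`. -/
def wordSum {α : Type} [Fintype α] [AddCommMonoid R] (n : ℕ) (f : List α → R) : R :=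
  ∑ a : Fin n → α, f (List.ofFn a)

lemma wordSum_zero {α : Type} [Fintype α] [AddCommMonoid R] (f : List α → R) :
    wordSum 0 f = f [] := by
  simp [wordSum]

lemma wordSum_succ {α : Type} [Fintype α] [AddCommMonoid R] (n : ℕ) (f : List α → R) :
    wordSum (n + 1) f = ∑ a, wordSum n fun w => f (a :: w) := by
  simp only [wordSum]
  rw [← (Fin.consEquiv fun _ => α).sum_comp, Fintype.sum_prod_type]
  simp [Fin.consEquiv, List.ofFn_succ]

lemma wordSum_congr {α : Type} [Fintype α] [AddCommMonoid R] {n : ℕ} {f g : List α → R}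
    (h : ∀ w, w.length = n → f w = g w) : wordSum n f = wordSum n g :=
  Finset.sum_congr rfl fun a _ => h _ (by simp)

lemma sum_finset_eq_wordSum [AddCommMonoid R] (n : ℕ) (f : List Bool → R) :
    ∑ G : Finset (Fin n), f (indicator G) = wordSum n f := by
  refine Finset.sum_bij' (fun G _ i => decide (i ∈ G)) (fun a _ => Finset.univ.filter (a · = true)) ?_ ?_ ?_ ?_ ?_
  all_goals intros
  all_goals simp [indicator]

/-- Splitting off the third of three blocks: the blocks `0` and `1` are marked. -/
def outerLeft (c : List (Fin 3)) : List Bool := c.map (· ≠ 2)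

/-- The subdivision of the blocks `0` and `1`. -/
def innerLeft (c : List (Fin 3)) : List Bool := (c.filter (· ≠ 2)).map (· = 0)

/-- Splitting off the first of three blocks. -/
def outerRight (c : List (Fin 3)) : List Bool := c.map (· = 0)

/-- The subdivision of the blocks `1` and `2`. -/
def innerRight (c : List (Fin 3)) : List Bool := (c.filter (· ≠ 0)).map (· = 1)

lemma wordSum_add {α : Type} [Fintype α] [AddCommMonoid R] (n : ℕ) (f g : List α → R) :
    (wordSum n fun w => f w + g w) = wordSum n f + wordSum n g :=
  Finset.sum_add_distrib

lemma wordSum_wordSum_left [AddCommMonoid R] (n : ℕ) (f : List Bool → List Bool → R) :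
    (wordSum n fun w => wordSum (w.count true) (f w)) =
      wordSum n fun c => f (outerLeft c) (innerLeft c) := by
  induction n generalizing f with
  | zero => simp [wordSum_zero, outerLeft, innerLeft]
  | succ n ih =>
    have h₀ := ih fun w v => f (true :: w) (true :: v)
    have h₁ := ih fun w v => f (true :: w) (false :: v)
    have h₂ := ih fun w v => f (false :: w) v
    simp only [wordSum_succ n, Fintype.sum_bool, Fin.sum_univ_three, List.count_cons_self,
      wordSum_succ (List.count _ _), wordSum_add]
    exact congrArg₂ (· + ·) (congrArg₂ (· + ·) h₀ h₁) h₂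

lemma wordSum_wordSum_right [AddCommMonoid R] (n : ℕ) (f : List Bool → List Bool → R) :
    (wordSum n fun w => wordSum (w.count false) (f w)) =
      wordSum n fun c => f (outerRight c) (innerRight c) := by
  induction n generalizing f with
  | zero => simp [wordSum_zero, outerRight, innerRight]
  | succ n ih =>
    have h₀ := ih fun w v => f (true :: w) v
    have h₁ := ih fun w v => f (false :: w) (true :: v)
    have h₂ := ih fun w v => f (false :: w) (false :: v)
    simp only [wordSum_succ n, Fintype.sum_bool, Fin.sum_univ_three, List.count_cons_self,
      wordSum_succ (List.count _ _), wordSum_add]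
    rw [add_assoc]
    exact congrArg₂ (· + ·) h₀ (congrArg₂ (· + ·) h₁ h₂)

lemma count_true_innerLeft (c : List (Fin 3)) :
    (innerLeft c).count true = (outerRight c).count true := by
  induction c with
  | nil => rfl
  | cons a c ih => fin_cases a <;> simp_all [innerLeft, outerRight]

lemma count_true_outerLeft (c : List (Fin 3)) :
    (outerLeft c).count true = (outerRight c).count true + (innerRight c).count true := by
  induction c with
  | nil => rfl
  | cons a c ih =>
    fin_cases a <;> simp_all [outerLeft, outerRight, innerRight] <;> omega

lemma wordSign_outerLeft_mul (c : List (Fin 3)) :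
    wordSign (outerLeft c) * wordSign (innerLeft c) =
      wordSign (outerRight c) * wordSign (innerRight c) := by
  induction c with
  | nil => rfl
  | cons a c ih =>
    fin_cases a
    · exact ih
    · change wordSign (outerLeft c) * ((-1) ^ (innerLeft c).count true * wordSign (innerLeft c)) =
        (-1) ^ (outerRight c).count true * wordSign (outerRight c) * wordSign (innerRight c)
      rw [count_true_innerLeft, mul_left_comm, ih, mul_assoc]
    · change (-1) ^ (outerLeft c).count true * wordSign (outerLeft c) * wordSign (innerLeft c) =
        (-1) ^ (outerRight c).count true * wordSign (outerRight c) *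
          ((-1) ^ (innerRight c).count true * wordSign (innerRight c))
      rw [count_true_outerLeft, pow_add, mul_assoc, ih]
      ring

lemma substWord_first (c : List (Fin 3)) :
    substWord ((outerLeft c).map (keep true false)) ((innerLeft c).map (keep true false)) =
      (outerRight c).map (keep true false) := by
  induction c with
  | nil => rfl
  | cons a c ih => fin_cases a <;> exact congrArg (List.cons _) ih

lemma substWord_second (c : List (Fin 3)) :
    substWord ((outerLeft c).map (keep true false)) ((innerLeft c).map (keep false true)) =
      substWord ((outerRight c).map (keep false true)) ((innerRight c).map (keep true false)) := by
  induction c with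
  | nil => rfl
  | cons a c ih => fin_cases a <;> exact congrArg (List.cons _) ih

lemma substWord_third (c : List (Fin 3)) :
    substWord ((outerRight c).map (keep false true)) ((innerRight c).map (keep false true)) =
      (outerLeft c).map (keep false true) := by
  induction c with
  | nil => rfl
  | cons a c ih => fin_cases a <;> exact congrArg (List.cons _) ih

lemma dim_wordFace_keep (b ε : Bool) (w : List Bool) (y : C.Cube) (h : w.length = y.1) :
    (C.wordFace 0 (w.map (keep b ε)) y).1 = w.count b := by
  have hdim := dim_wordFace 0 (w.map (keep b ε)) y (by simp [h])
  have hlen := w.length_eq_countP_add_countP (· == b)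
  rw [List.countP_map] at hdim
  have hkeep : w.countP (Option.isSome ∘ keep b ε) = w.countP (fun a => ¬ (a == b) = true) :=
    List.countP_congr fun a _ => by simp [keep]
  rw [List.count_eq_countP]
  omega

/-- The cup product of functions on cubes of arbitrary dimension. -/
def cubeCup [NonUnitalNonAssocRing R] (f g : C.Cube → R) (y : C.Cube) : R :=
  wordSum y.1 fun w => wordSign w •
    (f (C.wordFace 0 (w.map (keep true false)) y) * g (C.wordFace 0 (w.map (keep false true)) y))

lemma cubeCup_assoc [NonUnitalRing R] (f g h : C.Cube → R) :
    cubeCup (cubeCup f g) h = cubeCup f (cubeCup g h) := by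
  funext y
  trans wordSum y.1 fun w => wordSum (w.count true) fun v => (wordSign w * wordSign v) •
    (f (C.wordFace 0 (v.map (keep true false)) (C.wordFace 0 (w.map (keep true false)) y)) *
      g (C.wordFace 0 (v.map (keep false true)) (C.wordFace 0 (w.map (keep true false)) y)) *
      h (C.wordFace 0 (w.map (keep false true)) y))
  · refine wordSum_congr fun w hw => ?_
    rw [cubeCup, dim_wordFace_keep _ _ _ _ hw]
    simp only [wordSum, Finset.sum_mul, Finset.smul_sum, smul_mul_assoc, mul_smul]
  trans wordSum y.1 fun w => wordSum (w.count false) fun v => (wordSign w * wordSign v) •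
    (f (C.wordFace 0 (w.map (keep true false)) y) *
      (g (C.wordFace 0 (v.map (keep true false)) (C.wordFace 0 (w.map (keep false true)) y)) *
      h (C.wordFace 0 (v.map (keep false true)) (C.wordFace 0 (w.map (keep false true)) y))))
  · rw [wordSum_wordSum_left, wordSum_wordSum_right]
    refine wordSum_congr fun c _ => ?_
    simp only [wordFace_wordFace, substWord_first, substWord_second, substWord_third,
      wordSign_outerLeft_mul, mul_assoc]
  · refine wordSum_congr fun w hw => ?_
    rw [cubeCup, dim_wordFace_keep _ _ _ _ hw]
    simp only [wordSum, Finset.mul_sum, Finset.smul_sum, mul_smul_comm, mul_smul]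

/-- The extension by zero of a cochain to cubes of arbitrary dimension. -/
def extendCochain [Zero R] {p : ℕ} (φ : C.X p → R) (y : C.Cube) : R :=
  if h : y.1 = p then φ (cast (congrArg C.X h) y.2) else 0

lemma cup_eq_cubeCup [NonUnitalNonAssocRing R] {p q : ℕ} (φ : C.X p → R) (ψ : C.X q → R)
    (u : C.X (p + q)) :
    cup C φ ψ u = cubeCup (extendCochain φ) (extendCochain ψ) ⟨p + q, u⟩ := by
  rw [cup, cubeCup, ← sum_finset_eq_wordSum]
  refine Finset.sum_congr rfl fun G _ => ?_
  rw [← sigma_mface, ← sigma_mface_compl, shuffleSign_eq_wordSign]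
  split_ifs with h
  · have hc : Gᶜ.card = q := by
      rw [Finset.card_compl]; simp only [Fintype.card_fin]; omega
    simp only [extendCochain, h, hc, dif_pos]
  · simp [extendCochain, h]

lemma extendCochain_cup [NonUnitalNonAssocRing R] {p q : ℕ} (φ : C.X p → R) (ψ : C.X q → R) :
    extendCochain (cup C φ ψ) = cubeCup (extendCochain φ) (extendCochain ψ) := by
  funext ⟨n, x⟩
  by_cases h : n = p + q
  · subst h
    simp [extendCochain, cup_eq_cubeCup]
  · rw [extendCochain, dif_neg h, cubeCup, wordSum]
    symm
    refine Finset.sum_eq_zero fun a _ => ?_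
    have h₁ := dim_wordFace_keep true false (List.ofFn a) (⟨n, x⟩ : C.Cube) (by simp)
    have h₂ := dim_wordFace_keep false true (List.ofFn a) (⟨n, x⟩ : C.Cube) (by simp)
    have h₃ := List.count_true_add_count_false (List.ofFn a)
    simp only [List.length_ofFn] at h₃
    by_cases hp : (List.ofFn a).count true = p
    · have hq : (List.ofFn a).count false ≠ q := by omega
      rw [extendCochain.eq_def ψ, dif_neg (h₂ ▸ hq), mul_zero, smul_zero]
    · rw [extendCochain, dif_neg (h₁ ▸ hp), zero_mul, smul_zero]

end Precubical

/- Associativity of the cubical cup product on cochains. -/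
theorem cup_assoc (C : Precubical) (R : Type) [Ring R] (p q r : ℕ)
    (φ : C.X p → R) (ψ : C.X q → R) (χ : C.X r → R) (u : C.X (p + q + r)) :
    cup C (cup C φ ψ) χ u =
      cup C φ (cup C ψ χ) (cast (congrArg C.X (add_assoc p q r)) u) := by
  rw [Precubical.cup_eq_cubeCup, Precubical.cup_eq_cubeCup, Precubical.extendCochain_cup,
    Precubical.extendCochain_cup, Precubical.cubeCup_assoc,
    Precubical.sigma_mk_cast (add_assoc p q r)]
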